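/- Let λ ∈ ℂ and x ∈ ℝ³. For every infinitely differentiable, compactly supported function φ : ℝ³ → ℂ, the function y ↦ G(x, y; λ)·(−Δφ(y) + λ²φ(y)) is Lebesgue integrable on ℝ³ and ∫_{ℝ³} G(x, y; λ)·(−Δφ(y) + λ²φ(y)) dy = φ(x); that is, G(x, ·; λ) is a distributional fundamental solution of the Yukawa operator −Δ + λ². -/

import Mathlib

open MeasureTheory Filter Topology

noncomputable section

/-- ℝ³ with the Euclidean norm. -/
abbrev V3 : Type := EuclideanSpace ℝ (Fin 3)

/-- Partial derivative in the `i`-th coordinate direction of `f : ℝ³ → ℂ`. -/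
def pd (i : Fin 3) (f : V3 → ℂ) (x : V3) : ℂ :=
  fderiv ℝ f x (EuclideanSpace.single i 1)

/-- Componentwise Laplacian `Δf = ∂₁²f + ∂₂²f + ∂₃²f`. -/
def lap (f : V3 → ℂ) (x : V3) : ℂ :=
  ∑ i : Fin 3, pd i (fun y => pd i f y) x

/-- Curl of a vector field `u : ℝ³ → ℂ³`, defined cyclically:
`(curl u)ᵢ = ∂_{i+1} u_{i+2} − ∂_{i+2} u_{i+1}`. -/
def curl (u : V3 → Fin 3 → ℂ) (x : V3) : Fin 3 → ℂ :=
  fun i => pd (i + 1) (fun y => u y (i + 2)) x - pd (i + 2) (fun y => u y (i + 1)) x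

/-- The Yukawa kernel `G(x, y; λ) = e^{−λ‖x−y‖}/(4π‖x−y‖)`. -/
def G (lam : ℂ) (x y : V3) : ℂ :=
  Complex.exp (-lam * (‖x - y‖ : ℝ)) / ((4 * Real.pi * ‖x - y‖ : ℝ) : ℂ)

/-- The radial profile `e^{-λs}/(4πs)` of the Yukawa kernel. -/
def yukawaProfile (lam : ℂ) (s : ℝ) : ℂ :=
  Complex.exp (-lam * s) / (4 * Real.pi * s)

/-- The function `s⁻¹ (d/ds)` of `yukawaProfile`. -/
def yukawaProfile₁ (lam : ℂ) (s : ℝ) : ℂ :=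
  -(lam * s + 1) * Complex.exp (-lam * s) / (4 * Real.pi * s ^ 3)

/-- The function `s⁻¹ (d/ds)` of `yukawaProfile₁`. -/
def yukawaProfile₂ (lam : ℂ) (s : ℝ) : ℂ :=
  (lam ^ 2 * s ^ 2 + 3 * lam * s + 3) * Complex.exp (-lam * s) / (4 * Real.pi * s ^ 5)

/-- The smooth regularization `√(‖y - x‖² + ε²)` of the distance. -/
def regDist (ε : ℝ) (x y : V3) : ℝ := √(‖y - x‖ ^ 2 + ε ^ 2)

lemma hasDerivAt_cexp_neg_mul (lam : ℂ) (s : ℝ) :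
    HasDerivAt (fun s : ℝ => Complex.exp (-lam * s)) (-lam * Complex.exp (-lam * s)) s := by
  have h : HasDerivAt (fun s : ℝ => -lam * (s : ℂ)) (-lam) s := by
    simpa using (Complex.ofRealCLM.hasDerivAt (x := s)).const_mul (-lam)
  convert h.cexp using 1
  ring

lemma hasDerivAt_yukawaProfile (lam : ℂ) {s : ℝ} (hs : 0 < s) :
    HasDerivAt (yukawaProfile lam) (s * yukawaProfile₁ lam s) s := by
  have hs' : (s : ℂ) ≠ 0 := by exact_mod_cast hs.ne'
  have hpi : (Real.pi : ℂ) ≠ 0 := by exact_mod_cast Real.pi_ne_zero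
  have hid : HasDerivAt (fun s : ℝ => (s : ℂ)) 1 s := Complex.ofRealCLM.hasDerivAt
  have h := (hasDerivAt_cexp_neg_mul lam s).fun_div (hid.const_mul (4 * Real.pi : ℂ))
    (by simp [hs', hpi])
  refine h.congr_deriv ?_
  unfold yukawaProfile₁
  field_simp
  ring

lemma hasDerivAt_yukawaProfile₁ (lam : ℂ) {s : ℝ} (hs : 0 < s) :
    HasDerivAt (yukawaProfile₁ lam) (s * yukawaProfile₂ lam s) s := by
  have hs' : (s : ℂ) ≠ 0 := by exact_mod_cast hs.ne'
  have hpi : (Real.pi : ℂ) ≠ 0 := by exact_mod_cast Real.pi_ne_zero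
  have hid : HasDerivAt (fun s : ℝ => (s : ℂ)) 1 s := Complex.ofRealCLM.hasDerivAt
  have h := ((((hid.const_mul lam).add_const 1).fun_neg).fun_mul
    (hasDerivAt_cexp_neg_mul lam s)).fun_div ((hid.fun_pow 3).const_mul (4 * Real.pi : ℂ))
    (by simp [hs', hpi])
  refine h.congr_deriv ?_
  unfold yukawaProfile₂
  field_simp
  push_cast
  ring

lemma regDist_pos {ε : ℝ} (hε : 0 < ε) (x y : V3) : 0 < regDist ε x y :=
  Real.sqrt_pos.mpr (by positivity)

lemma regDist_sq (ε : ℝ) (x y : V3) : regDist ε x y ^ 2 = ‖y - x‖ ^ 2 + ε ^ 2 :=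
  Real.sq_sqrt (by positivity)

lemma norm_sub_le_regDist (ε : ℝ) (x y : V3) : ‖y - x‖ ≤ regDist ε x y :=
  Real.le_sqrt_of_sq_le (by nlinarith [sq_nonneg ε])

lemma regDist_le {ε : ℝ} (hε : 0 ≤ ε) (x y : V3) : regDist ε x y ≤ ‖y - x‖ + ε :=
  (Real.sqrt_le_left (by positivity)).mpr (by nlinarith [mul_nonneg (norm_nonneg (y - x)) hε])

lemma continuous_regDist (ε : ℝ) (x : V3) : Continuous (regDist ε x) := by
  unfold regDist
  fun_prop

lemma tendsto_regDist (x y : V3) :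
    Tendsto (fun ε => regDist ε x y) (𝓝[>] 0) (𝓝 ‖y - x‖) := by
  have h : Continuous (fun ε => regDist ε x y) := by
    unfold regDist
    fun_prop
  have := (h.tendsto 0).mono_left (nhdsWithin_le_nhds (s := Set.Ioi 0))
  simpa [regDist] using this

lemma regDist_add_smul {ε : ℝ} (hε : 0 < ε) (x z : V3) :
    regDist ε x (x + ε • z) = ε * √(1 + ‖z‖ ^ 2) := by
  rw [regDist, add_sub_cancel_left, norm_smul, Real.norm_of_nonneg hε.le,
    ← Real.sqrt_sq hε.le, ← Real.sqrt_mul (sq_nonneg _), Real.sqrt_sq hε.le]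
  ring_nf

lemma hasFDerivAt_regDist {ε : ℝ} (hε : 0 < ε) (x y : V3) :
    HasFDerivAt (regDist ε x) ((regDist ε x y)⁻¹ • innerSL ℝ (y - x)) y := by
  have h1 : HasFDerivAt (fun y : V3 => ‖y - x‖ ^ 2 + ε ^ 2) (2 • innerSL ℝ (y - x)) y := by
    simpa using (((hasFDerivAt_id y).sub_const x).norm_sq).add_const (ε ^ 2)
  refine (h1.sqrt (by positivity)).congr_fderiv ?_
  ext v
  simp only [regDist, smul_apply, smul_eq_mul, nsmul_eq_mul]
  field_simp
  simp

lemma hasFDerivAt_comp_regDist {ε : ℝ} (hε : 0 < ε) (x y : V3) {g g' : ℝ → ℂ}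
    (hg : ∀ s, 0 < s → HasDerivAt g (s * g' s) s) :
    HasFDerivAt (fun y => g (regDist ε x y))
      ((innerSL ℝ (y - x)).smulRight (g' (regDist ε x y))) y := by
  have hs := regDist_pos hε x y
  have h := (hg _ hs).hasFDerivAt.comp y (hasFDerivAt_regDist hε x y)
  refine h.congr_fderiv ?_
  ext v
  have hs' : (regDist ε x y : ℂ) ≠ 0 := by exact_mod_cast hs.ne'
  simp
  field_simp

lemma pd_comp_regDist {ε : ℝ} (hε : 0 < ε) (x y : V3) {g g' : ℝ → ℂ}
    (hg : ∀ s, 0 < s → HasDerivAt g (s * g' s) s) (i : Fin 3) :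
    pd i (fun y => g (regDist ε x y)) y = ((y - x) i : ℝ) * g' (regDist ε x y) := by
  rw [pd, (hasFDerivAt_comp_regDist hε x y hg).fderiv]
  simp [EuclideanSpace.inner_single_right]

lemma hasFDerivAt_coord_sub (x y : V3) (i : Fin 3) :
    HasFDerivAt (fun y : V3 => (((y - x) i : ℝ) : ℂ))
      (Complex.ofRealCLM ∘L (EuclideanSpace.proj i : V3 →L[ℝ] ℝ)) y := by
  have h := (Complex.ofRealCLM ∘L (EuclideanSpace.proj i : V3 →L[ℝ] ℝ)).hasFDerivAt.comp y
    ((hasFDerivAt_id y).sub_const x)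
  exact h

lemma hasFDerivAt_coord_mul_comp_regDist {ε : ℝ} (hε : 0 < ε) (x y : V3) {g g' : ℝ → ℂ}
    (hg : ∀ s, 0 < s → HasDerivAt g (s * g' s) s) (i : Fin 3) :
    DifferentiableAt ℝ (fun y : V3 => (((y - x) i : ℝ) : ℂ) * g (regDist ε x y)) y ∧
    pd i (fun y : V3 => (((y - x) i : ℝ) : ℂ) * g (regDist ε x y)) y =
      g (regDist ε x y) + (((y - x) i : ℝ) : ℂ) ^ 2 * g' (regDist ε x y) := by
  have h := (hasFDerivAt_coord_sub x y i).fun_mul (hasFDerivAt_comp_regDist hε x y hg)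
  refine ⟨h.differentiableAt, ?_⟩
  rw [pd, h.fderiv]
  simp [EuclideanSpace.inner_single_right]
  ring

lemma continuous_of_hasDerivAt_pos {g g' : ℝ → ℂ} (hg : ∀ s, 0 < s → HasDerivAt g (g' s) s)
    {ε : ℝ} (hε : 0 < ε) (x : V3) : Continuous (fun y => g (regDist ε x y)) :=
  continuous_iff_continuousAt.mpr fun y =>
    ContinuousAt.comp (f := regDist ε x) (hg _ (regDist_pos hε x y)).continuousAt
      (continuous_regDist ε x).continuousAt

lemma continuous_yukawaProfile₂_regDist (lam : ℂ) {ε : ℝ} (hε : 0 < ε) (x : V3) :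
    Continuous (fun y => yukawaProfile₂ lam (regDist ε x y)) := by
  have := continuous_regDist ε x
  unfold yukawaProfile₂
  refine Continuous.div (by fun_prop) (by fun_prop) fun y => ?_
  have : (regDist ε x y : ℂ) ≠ 0 := by exact_mod_cast (regDist_pos hε x y).ne'
  have hpi : (Real.pi : ℂ) ≠ 0 := by exact_mod_cast Real.pi_ne_zero
  simp [*]

lemma contDiff_pd {f : V3 → ℂ} (hf : ContDiff ℝ (⊤ : ℕ∞) f) (i : Fin 3) :
    ContDiff ℝ (⊤ : ℕ∞) (pd i f) :=
  (hf.fderiv_right (m := (⊤ : ℕ∞)) (by exact_mod_cast le_rfl)).clm_apply contDiff_const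

lemma hasCompactSupport_pd {f : V3 → ℂ} (hf : HasCompactSupport f) (i : Fin 3) :
    HasCompactSupport (pd i f) :=
  hf.fderiv_apply (𝕜 := ℝ) _

/-- Integration by parts of a partial derivative against a compactly supported function. -/
lemma integral_mul_pd {f g : V3 → ℂ} {i : Fin 3} (hf : Differentiable ℝ f)
    (hf' : Continuous (pd i f)) (hg : ContDiff ℝ (⊤ : ℕ∞) g) (hgs : HasCompactSupport g) :
    ∫ y, f y * pd i g y = -∫ y, pd i f y * g y :=
  integral_mul_fderiv_eq_neg_fderiv_mul_of_integrable
    ((hf'.mul hg.continuous).integrable_of_hasCompactSupport hgs.mul_left)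
    ((hf.continuous.mul (contDiff_pd hg i).continuous).integrable_of_hasCompactSupport
      (hasCompactSupport_pd hgs i).mul_left)
    ((hf.continuous.mul hg.continuous).integrable_of_hasCompactSupport hgs.mul_left)
    (fun y _ => hf y) (fun y _ => hg.differentiable (by simp) y)

lemma continuous_lap {φ : V3 → ℂ} (hφ : ContDiff ℝ (⊤ : ℕ∞) φ) : Continuous (lap φ) :=
  continuous_finsetSum _ fun i _ => (contDiff_pd (contDiff_pd hφ i) i).continuous

lemma hasCompactSupport_yukawa {φ : V3 → ℂ} (hφs : HasCompactSupport φ) (lam : ℂ) :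
    HasCompactSupport (fun y => -(lap φ y) + lam ^ 2 * φ y) := by
  have h (i : Fin 3) : HasCompactSupport (pd i (pd i φ)) :=
    hasCompactSupport_pd (hasCompactSupport_pd hφs i) i
  have hl : HasCompactSupport (lap φ) := by
    have he : lap φ = pd 0 (pd 0 φ) + pd 1 (pd 1 φ) + pd 2 (pd 2 φ) := by
      ext y
      simp [lap, Fin.sum_univ_three]
    rw [he]
    exact ((h 0).add (h 1)).add (h 2)
  exact hl.neg.add hφs.mul_left

lemma integral_yukawaProfile_mul_pd_pd (lam : ℂ) {ε : ℝ} (hε : 0 < ε) (x : V3) {φ : V3 → ℂ}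
    (hφ : ContDiff ℝ (⊤ : ℕ∞) φ) (hφs : HasCompactSupport φ) (i : Fin 3) :
    ∫ y, yukawaProfile lam (regDist ε x y) * pd i (pd i φ) y =
      ∫ y, (yukawaProfile₁ lam (regDist ε x y) +
        (((y - x) i : ℝ) : ℂ) ^ 2 * yukawaProfile₂ lam (regDist ε x y)) * φ y := by
  have h0 : ∀ s, 0 < s → HasDerivAt (yukawaProfile lam) (s * yukawaProfile₁ lam s) s :=
    fun s hs => hasDerivAt_yukawaProfile lam hs
  have h1 : ∀ s, 0 < s → HasDerivAt (yukawaProfile₁ lam) (s * yukawaProfile₂ lam s) s :=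
    fun s hs => hasDerivAt_yukawaProfile₁ lam hs
  have c1 := continuous_of_hasDerivAt_pos h1 hε x
  have c2 := continuous_yukawaProfile₂_regDist lam hε x
  have cc : Continuous fun y : V3 => (((y - x) i : ℝ) : ℂ) :=
    continuous_iff_continuousAt.mpr fun y => (hasFDerivAt_coord_sub x y i).continuousAt
  have p0 : pd i (fun y => yukawaProfile lam (regDist ε x y)) =
      fun y => (((y - x) i : ℝ) : ℂ) * yukawaProfile₁ lam (regDist ε x y) :=
    funext fun y => pd_comp_regDist hε x y h0 i
  have p1 : pd i (fun y => (((y - x) i : ℝ) : ℂ) * yukawaProfile₁ lam (regDist ε x y)) =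
      fun y => yukawaProfile₁ lam (regDist ε x y) +
        (((y - x) i : ℝ) : ℂ) ^ 2 * yukawaProfile₂ lam (regDist ε x y) :=
    funext fun y => (hasFDerivAt_coord_mul_comp_regDist hε x y h1 i).2
  rw [integral_mul_pd (fun y => (hasFDerivAt_comp_regDist hε x y h0).differentiableAt)
    (by rw [p0]; exact cc.mul c1) (contDiff_pd hφ i) (hasCompactSupport_pd hφs i), p0,
    integral_mul_pd (fun y => (hasFDerivAt_coord_mul_comp_regDist hε x y h1 i).1)
    (by rw [p1]; fun_prop) hφ hφs, p1, neg_neg]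

lemma integral_regularized (lam : ℂ) {ε : ℝ} (hε : 0 < ε) (x : V3) {φ : V3 → ℂ}
    (hφ : ContDiff ℝ (⊤ : ℕ∞) φ) (hφs : HasCompactSupport φ) :
    ∫ y, yukawaProfile lam (regDist ε x y) * (-(lap φ y) + lam ^ 2 * φ y) =
      ∫ y, (ε : ℂ) ^ 2 * yukawaProfile₂ lam (regDist ε x y) * φ y := by
  have h0 : ∀ s, 0 < s → HasDerivAt (yukawaProfile lam) (s * yukawaProfile₁ lam s) s :=
    fun s hs => hasDerivAt_yukawaProfile lam hs
  have h1 : ∀ s, 0 < s → HasDerivAt (yukawaProfile₁ lam) (s * yukawaProfile₂ lam s) s :=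
    fun s hs => hasDerivAt_yukawaProfile₁ lam hs
  have c0 := continuous_of_hasDerivAt_pos h0 hε x
  have c1 := continuous_of_hasDerivAt_pos h1 hε x
  have c2 := continuous_yukawaProfile₂_regDist lam hε x
  have cc (i : Fin 3) : Continuous fun y : V3 => (((y - x) i : ℝ) : ℂ) :=
    continuous_iff_continuousAt.mpr fun y => (hasFDerivAt_coord_sub x y i).continuousAt
  have cφ := hφ.continuous
  have i0 (i : Fin 3) : Integrable
      (fun y => yukawaProfile lam (regDist ε x y) * pd i (pd i φ) y) :=
    (c0.mul (contDiff_pd (contDiff_pd hφ i) i).continuous).integrable_of_hasCompactSupport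
      (hasCompactSupport_pd (hasCompactSupport_pd hφs i) i).mul_left
  have iφ : Integrable (fun y => yukawaProfile lam (regDist ε x y) * (lam ^ 2 * φ y)) :=
    (c0.mul (continuous_const.mul cφ)).integrable_of_hasCompactSupport hφs.mul_left.mul_left
  have i1 (i : Fin 3) : Integrable (fun y => (yukawaProfile₁ lam (regDist ε x y) +
      (((y - x) i : ℝ) : ℂ) ^ 2 * yukawaProfile₂ lam (regDist ε x y)) * φ y) :=
    ((c1.add (((cc i).pow 2).mul c2)).mul cφ).integrable_of_hasCompactSupport hφs.mul_left
  calc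
    _ = ∫ y, (yukawaProfile lam (regDist ε x y) * (lam ^ 2 * φ y) -
          ∑ i, yukawaProfile lam (regDist ε x y) * pd i (pd i φ) y) := by
      congr 1 with y
      rw [← Finset.mul_sum, lap]
      ring
    _ = (∫ y, yukawaProfile lam (regDist ε x y) * (lam ^ 2 * φ y)) -
          ∑ i, ∫ y, (yukawaProfile₁ lam (regDist ε x y) +
            (((y - x) i : ℝ) : ℂ) ^ 2 * yukawaProfile₂ lam (regDist ε x y)) * φ y := by
      rw [integral_sub iφ (integrable_finsetSum _ fun i _ => i0 i),
        integral_finsetSum _ fun i _ => i0 i]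
      congr 1
      exact Finset.sum_congr rfl fun i _ => integral_yukawaProfile_mul_pd_pd lam hε x hφ hφs i
    _ = ∫ y, (yukawaProfile lam (regDist ε x y) * (lam ^ 2 * φ y) -
          ∑ i : Fin 3, (yukawaProfile₁ lam (regDist ε x y) +
            (((y - x) i : ℝ) : ℂ) ^ 2 * yukawaProfile₂ lam (regDist ε x y)) * φ y) := by
      rw [integral_sub iφ (integrable_finsetSum _ fun i _ => i1 i),
        integral_finsetSum _ fun i _ => i1 i]
    _ = _ := by
      congr 1 with y
      have hs : (regDist ε x y : ℂ) ≠ 0 := by exact_mod_cast (regDist_pos hε x y).ne'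
      have hpi : (Real.pi : ℂ) ≠ 0 := by exact_mod_cast Real.pi_ne_zero
      have hsq : (regDist ε x y : ℂ) ^ 2 = (((y - x) 0 : ℝ) : ℂ) ^ 2 +
          (((y - x) 1 : ℝ) : ℂ) ^ 2 + (((y - x) 2 : ℝ) : ℂ) ^ 2 + (ε : ℂ) ^ 2 := by
        have := regDist_sq ε x y
        rw [EuclideanSpace.real_norm_sq_eq, Fin.sum_univ_three] at this
        exact_mod_cast this
      have hode : lam ^ 2 * yukawaProfile lam (regDist ε x y) =
          3 * yukawaProfile₁ lam (regDist ε x y) +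
            (regDist ε x y : ℂ) ^ 2 * yukawaProfile₂ lam (regDist ε x y) := by
        unfold yukawaProfile yukawaProfile₁ yukawaProfile₂
        field_simp
        ring
      rw [Fin.sum_univ_three]
      linear_combination φ y * hode + yukawaProfile₂ lam (regDist ε x y) * φ y * hsq

lemma integrable_inv_norm_sub_mul (x : V3) {ψ : V3 → ℝ} (hψ : Continuous ψ)
    (hψs : HasCompactSupport ψ) : Integrable (fun y => ‖y - x‖⁻¹ * ψ y) := by
  have hloc : LocallyIntegrable (fun y : V3 => ‖y‖⁻¹) := by
    refine locallyIntegrable_of_norm_le_rpow (C := 1) (α := 1) (by simp) (by simp)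
      (ae_of_all _ fun y => ?_) (by fun_prop)
    simp [Real.rpow_neg_one]
  have h := hloc.integrable_smul_right_of_hasCompactSupport (g := fun y => ψ (y + x))
    (by fun_prop) (hψs.comp_homeomorph (Homeomorph.addRight x))
  simpa using h.comp_sub_right x

lemma integral_bubble :
    ∫ z : V3, 3 / (4 * Real.pi) * (1 / √(1 + ‖z‖ ^ 2) ^ 5) = 1 := by
  have hv : (volume : Measure V3).real (Metric.ball 0 1) = Real.pi * 4 / 3 := by
    rw [measureReal_def, EuclideanSpace.volume_ball_fin_three]
    simp
    positivity
  have hpos (r : ℝ) : 0 < 1 + r ^ 2 := by positivity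
  have hd (r : ℝ) : HasDerivAt (fun r : ℝ => (r / √(1 + r ^ 2)) ^ 3)
      (3 * (r ^ 2 * (1 / √(1 + r ^ 2) ^ 5))) r := by
    have h1 : HasDerivAt (fun r : ℝ => 1 + r ^ 2) (2 * r) r := by
      simpa using ((hasDerivAt_id r).pow 2).const_add 1
    have hne := (Real.sqrt_pos.mpr (hpos r)).ne'
    refine (((hasDerivAt_id r).fun_div (h1.sqrt (hpos r).ne') hne).fun_pow 3).congr_deriv ?_
    have hsq := Real.sq_sqrt (hpos r).le
    simp only [id]
    generalize √(1 + r ^ 2) = s at hne hsq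
    push_cast
    field_simp
    linear_combination r ^ 2 * hsq
  have hlim : Tendsto (fun r : ℝ => (r / √(1 + r ^ 2)) ^ 3) atTop (𝓝 1) := by
    have h2 : Tendsto (fun r : ℝ => (√((r ^ 2)⁻¹ + 1))⁻¹ ^ 3) atTop (𝓝 ((√(0 + 1))⁻¹ ^ 3)) := by
      have h3 : Tendsto (fun r : ℝ => (r ^ 2)⁻¹) atTop (𝓝 0) :=
        (tendsto_pow_atTop two_ne_zero).inv_tendsto_atTop
      exact ((h3.add_const 1).sqrt.inv₀ (by simp)).pow 3
    simp only [zero_add, Real.sqrt_one, inv_one, one_pow] at h2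
    refine h2.congr' ?_
    filter_upwards [eventually_gt_atTop 0] with r hr
    have : 1 + r ^ 2 = r ^ 2 * ((r ^ 2)⁻¹ + 1) := by field_simp
    rw [this, Real.sqrt_mul (sq_nonneg r), Real.sqrt_sq hr.le]
    field_simp
  have hint : ∫ r in Set.Ioi (0 : ℝ), 3 * (r ^ 2 * (1 / √(1 + r ^ 2) ^ 5)) = 1 := by
    rw [integral_Ioi_of_hasDerivAt_of_nonneg' (fun r _ => hd r) (fun r _ => by positivity) hlim]
    simp
  rw [integral_const_mul, integral_fun_norm_addHaar volume (fun r => 1 / √(1 + r ^ 2) ^ 5), hv]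
  rw [integral_const_mul] at hint
  simp only [finrank_euclideanSpace, Fintype.card_fin, smul_eq_mul, nsmul_eq_mul]
  have hpi := Real.pi_ne_zero
  norm_num at hint ⊢
  field_simp at hint ⊢
  linarith

lemma integrable_bubble : Integrable (fun z : V3 => 1 / √(1 + ‖z‖ ^ 2) ^ 5) := by
  by_contra h
  have h2 := integral_bubble
  rw [integral_const_mul, integral_undef h] at h2
  simp at h2

lemma norm_cexp_neg_mul_le (lam : ℂ) {s R : ℝ} (hs : 0 ≤ s) (hsR : s ≤ R) :
    ‖Complex.exp (-lam * s)‖ ≤ Real.exp (‖lam‖ * R) := by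
  refine (Complex.norm_exp_le_exp_norm _).trans (Real.exp_le_exp.mpr ?_)
  rw [norm_mul, norm_neg, Complex.norm_real, Real.norm_of_nonneg hs]
  gcongr

lemma norm_yukawaProfile_le (lam : ℂ) {r s R : ℝ} (hr : 0 < r) (hrs : r ≤ s) (hsR : s ≤ R) :
    ‖yukawaProfile lam s‖ ≤ r⁻¹ * (Real.exp (‖lam‖ * R) / (4 * Real.pi)) := by
  have hs := hr.trans_le hrs
  have hpi := Real.pi_pos
  have hn : ‖(4 * Real.pi * s : ℂ)‖ = 4 * Real.pi * s := by
    simp [abs_of_pos hs, abs_of_pos hpi]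
  rw [yukawaProfile, norm_div, hn]
  calc
    _ ≤ Real.exp (‖lam‖ * R) / (4 * Real.pi * r) := by
      gcongr
      exact norm_cexp_neg_mul_le lam hs.le hsR
    _ = _ := by field_simp

lemma G_eq_yukawaProfile (lam : ℂ) (x y : V3) : G lam x y = yukawaProfile lam ‖y - x‖ := by
  simp [G, yukawaProfile, norm_sub_rev x y]

lemma integrable_yukawa_bound (lam : ℂ) (x : V3) {ψ : V3 → ℂ} (hψ : Continuous ψ)
    (hψs : HasCompactSupport ψ) :
    Integrable (fun y => ‖y - x‖⁻¹ *
      (Real.exp (‖lam‖ * (‖y - x‖ + 1)) / (4 * Real.pi) * ‖ψ y‖)) :=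
  integrable_inv_norm_sub_mul x (by fun_prop) hψs.norm.mul_left

lemma ae_norm_sub_pos (x : V3) : ∀ᵐ y : V3, 0 < ‖y - x‖ := by
  filter_upwards [compl_mem_ae_iff.mpr (measure_singleton (μ := volume) x)] with y hy
  exact norm_pos_iff.mpr (sub_ne_zero.mpr hy)

/-- The Yukawa kernel is locally integrable against continuous compactly supported functions. -/
lemma integrable_G_mul (lam : ℂ) (x : V3) {ψ : V3 → ℂ} (hψ : Continuous ψ)
    (hψs : HasCompactSupport ψ) : Integrable (fun y => G lam x y * ψ y) := by
  refine (integrable_yukawa_bound lam x hψ hψs).mono' ?_ ?_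
  · refine AEStronglyMeasurable.mul ?_ hψ.aestronglyMeasurable
    refine Measurable.aestronglyMeasurable ?_
    unfold G
    fun_prop
  · filter_upwards [ae_norm_sub_pos x] with y hy
    rw [G_eq_yukawaProfile, norm_mul, ← mul_assoc]
    gcongr
    exact norm_yukawaProfile_le lam hy le_rfl (by linarith)

lemma tendsto_integral_yukawaProfile_regDist (lam : ℂ) (x : V3) {ψ : V3 → ℂ}
    (hψ : Continuous ψ) (hψs : HasCompactSupport ψ) :
    Tendsto (fun ε => ∫ y, yukawaProfile lam (regDist ε x y) * ψ y) (𝓝[>] 0)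
      (𝓝 (∫ y, G lam x y * ψ y)) := by
  refine tendsto_integral_filter_of_dominated_convergence _ ?_ ?_
    (integrable_yukawa_bound lam x hψ hψs) ?_
  · filter_upwards [self_mem_nhdsWithin] with ε hε
    exact ((continuous_of_hasDerivAt_pos (fun s hs => hasDerivAt_yukawaProfile lam hs)
      hε x).mul hψ).aestronglyMeasurable
  · filter_upwards [Ioc_mem_nhdsGT one_pos] with ε hε
    filter_upwards [ae_norm_sub_pos x] with y hy
    rw [norm_mul, ← mul_assoc]
    gcongr
    exact norm_yukawaProfile_le lam hy (norm_sub_le_regDist ε x y)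
      ((regDist_le hε.1.le x y).trans (by linarith [hε.2]))
  · filter_upwards [ae_norm_sub_pos x] with y hy
    rw [G_eq_yukawaProfile]
    exact ((hasDerivAt_yukawaProfile lam hy).continuousAt.tendsto.comp
      (tendsto_regDist x y)).mul_const _

lemma integral_eq_pow_smul_integral_add_smul (f : V3 → ℂ) {ε : ℝ} (hε : 0 < ε) (x : V3) :
    ∫ y, f y = ∫ z, (ε : ℂ) ^ 3 * f (x + ε • z) := by
  rw [integral_const_mul, Measure.integral_comp_smul volume (fun y => f (x + y)),
    integral_add_left_eq_self f x, abs_of_nonneg (by positivity)]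
  have : (ε : ℂ) ≠ 0 := by exact_mod_cast hε.ne'
  simp [this]

/-- The regularized operator applied to the regularized kernel is an approximate identity. -/
lemma tendsto_integral_yukawaProfile₂ (lam : ℂ) (x : V3) {φ : V3 → ℂ}
    (hφ : Continuous φ) (hφs : HasCompactSupport φ) :
    Tendsto (fun ε : ℝ => ∫ y, (ε : ℂ) ^ 2 * yukawaProfile₂ lam (regDist ε x y) * φ y) (𝓝[>] 0)
      (𝓝 (φ x)) := by
  let Q : ℝ → ℂ := fun s =>
    (lam ^ 2 * s ^ 2 + 3 * lam * s + 3) * Complex.exp (-lam * s) / (4 * Real.pi)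
  have hQ : Continuous Q := by fun_prop
  let F : ℝ → V3 → ℂ := fun ε z =>
    ((1 / √(1 + ‖z‖ ^ 2) ^ 5 : ℝ) : ℂ) * (Q (regDist ε x (x + ε • z)) * φ (x + ε • z))
  have hσ (z : V3) : 0 < √(1 + ‖z‖ ^ 2) := Real.sqrt_pos.mpr (by positivity)
  have hF : ∀ ε : ℝ, 0 < ε →
      ∫ z, F ε z = ∫ y, (ε : ℂ) ^ 2 * yukawaProfile₂ lam (regDist ε x y) * φ y := by
    intro ε hε
    rw [integral_eq_pow_smul_integral_add_smul
      (fun y => (ε : ℂ) ^ 2 * yukawaProfile₂ lam (regDist ε x y) * φ y) hε x]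
    congr 1 with z
    have h1 : (ε : ℂ) ≠ 0 := by exact_mod_cast hε.ne'
    have h2 : (√(1 + ‖z‖ ^ 2) : ℂ) ≠ 0 := by exact_mod_cast (hσ z).ne'
    have hpi : (Real.pi : ℂ) ≠ 0 := by exact_mod_cast Real.pi_ne_zero
    simp only [F, Q, yukawaProfile₂, regDist_add_smul hε]
    generalize √(1 + ‖z‖ ^ 2) = σ at h2
    push_cast
    field_simp
  obtain ⟨C, hC⟩ : ∃ C, ∀ y, ‖(‖lam‖ ^ 2 * (‖y - x‖ + 1) ^ 2 + 3 * ‖lam‖ * (‖y - x‖ + 1) + 3) *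
      Real.exp (‖lam‖ * (‖y - x‖ + 1)) / (4 * Real.pi) * ‖φ y‖‖ ≤ C :=
    Continuous.bounded_above_of_compact_support (by fun_prop) hφs.norm.mul_left
  have hbound : ∀ ε ∈ Set.Ioc (0 : ℝ) 1, ∀ y, ‖Q (regDist ε x y) * φ y‖ ≤ C := by
    intro ε hε y
    refine le_trans ?_ ((le_abs_self _).trans (hC y))
    have hs := regDist_pos hε.1 x y
    have hs1 : regDist ε x y ≤ ‖y - x‖ + 1 :=
      (regDist_le hε.1.le x y).trans (by linarith [hε.2])
    have hn : ‖(4 * Real.pi : ℂ)‖ = 4 * Real.pi := by simp [abs_of_pos Real.pi_pos]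
    have hpi := Real.pi_pos
    rw [norm_mul, norm_div, norm_mul, hn]
    gcongr
    · refine (norm_add₃_le ..).trans ?_
      simp only [norm_mul, norm_pow, Complex.norm_real, Real.norm_of_nonneg hs.le,
        Complex.norm_ofNat]
      gcongr
    · exact norm_cexp_neg_mul_le lam hs.le hs1
  have hlim : Tendsto (fun ε => ∫ z, F ε z) (𝓝[>] 0)
      (𝓝 (∫ z : V3, ((1 / √(1 + ‖z‖ ^ 2) ^ 5 : ℝ) : ℂ) * (Q 0 * φ x))) := by
    refine tendsto_integral_filter_of_dominated_convergence
      (fun z => 1 / √(1 + ‖z‖ ^ 2) ^ 5 * C) ?_ ?_ (integrable_bubble.mul_const C) ?_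
    · refine Eventually.of_forall fun ε => ?_
      have := continuous_regDist ε x
      refine Continuous.aestronglyMeasurable ?_
      refine (Complex.continuous_ofReal.comp ?_).mul (by fun_prop)
      exact Continuous.div (by fun_prop) (by fun_prop) fun z => (pow_pos (hσ z) 5).ne'
    · filter_upwards [Ioc_mem_nhdsGT one_pos] with ε hε
      refine ae_of_all _ fun z => ?_
      rw [norm_mul, Complex.norm_real, Real.norm_of_nonneg (by positivity)]
      gcongr
      exact hbound ε hε _
    · refine ae_of_all _ fun z => ?_
      have hc : Continuous fun ε : ℝ => F ε z := by
        simp only [F, regDist]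
        fun_prop
      have := (hc.tendsto 0).mono_left (nhdsWithin_le_nhds (s := Set.Ioi 0))
      simpa [F, regDist] using this
  have hval : ∫ z : V3, ((1 / √(1 + ‖z‖ ^ 2) ^ 5 : ℝ) : ℂ) * (Q 0 * φ x) = φ x := by
    have hone := integral_bubble
    rw [integral_const_mul] at hone
    rw [integral_mul_const, integral_complex_ofReal, ← mul_assoc]
    have hQ0 : Q 0 = ((3 / (4 * Real.pi) : ℝ) : ℂ) := by simp [Q]
    rw [hQ0, ← Complex.ofReal_mul, mul_comm (∫ z : V3, _) _, hone]
    simp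
  rw [hval] at hlim
  refine hlim.congr' ?_
  filter_upwards [self_mem_nhdsWithin] with ε hε using hF ε hε

/-- `G(x, ·; λ)` is a distributional fundamental solution of the Yukawa
operator `−Δ + λ²`: for every smooth compactly supported `φ`, the function
`y ↦ G(x, y; λ)(−Δφ(y) + λ²φ(y))` is integrable and its integral equals `φ(x)`. -/
theorem yukawa_kernel_fundamental_solution (lam : ℂ) (x : V3) (φ : V3 → ℂ)
    (hφ : ContDiff ℝ (⊤ : ℕ∞) φ) (hφsupp : HasCompactSupport φ) :
    Integrable (fun y => G lam x y * (-(lap φ y) + lam ^ 2 * φ y)) ∧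
    (∫ y : V3, G lam x y * (-(lap φ y) + lam ^ 2 * φ y)) = φ x := by
  have hψ : Continuous fun y => -(lap φ y) + lam ^ 2 * φ y :=
    (continuous_lap hφ).neg.add (continuous_const.mul hφ.continuous)
  have hψs := hasCompactSupport_yukawa hφsupp lam
  refine ⟨integrable_G_mul lam x hψ hψs, ?_⟩
  refine tendsto_nhds_unique (tendsto_integral_yukawaProfile_regDist lam x hψ hψs)
    ((tendsto_integral_yukawaProfile₂ lam x hφ.continuous hφsupp).congr' ?_)
  filter_upwards [self_mem_nhdsWithin] with ε hε
  exact (integral_regularized lam hε x hφ hφsupp).symm
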